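/- Let H be a complex Hilbert space, let ε ∈ {1,-1}, let T : H → H be a bijective real-linear map that is conjugate-linear (T(z•v) = conj(z)•T(v) for all z ∈ ℂ) with T ∘ T = ε • id, and let Γ : H → H be a complex-linear map with Γ ∘ Γ = id and Γ ∘ T = T ∘ Γ. Let J : H → H be multiplication by the imaginary unit, J(v) = i • v. Then, as real-linear maps, J, T, and K := J ∘ T ∘ Γ pairwise anticommute, and J ∘ J = -id, T ∘ T = ε • id, K ∘ K = ε • id. -/

import Mathlib

/-- Tenfold way, class A = {1,T}: if `T` is a conjugate-linear bijection of a complex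
Hilbert space with `T² = ε·id` (`ε = ±1`) commuting with a complex-linear grading `Γ`
(`Γ² = id`), then `J := i•(·)`, `T`, and `K := i•T(Γ(·))` pairwise anticommute as
real-linear maps, with `J² = -id`, `T² = ε·id`, `K² = ε·id`. -/
theorem stmt_15 {H : Type*} [NormedAddCommGroup H] [InnerProductSpace ℂ H]
    [CompleteSpace H]
    (ε : ℝ) (hε : ε = 1 ∨ ε = -1)
    (T : H →ₛₗ[starRingEnd ℂ] H) (hTbij : Function.Bijective T)
    (hT2 : ∀ v, T (T v) = ε • v)
    (Γ : H →ₗ[ℂ] H) (hΓ2 : ∀ v, Γ (Γ v) = v)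
    (hΓT : ∀ v, Γ (T v) = T (Γ v)) :
    (∀ v : H, Complex.I • T v = -(T (Complex.I • v))) ∧
    (∀ v : H, Complex.I • (Complex.I • T (Γ v)) = -(Complex.I • T (Γ (Complex.I • v)))) ∧
    (∀ v : H, T (Complex.I • T (Γ v)) = -(Complex.I • T (Γ (T v)))) ∧
    (∀ v : H, Complex.I • Complex.I • v = -v) ∧
    (∀ v : H, T (T v) = ε • v) ∧
    (∀ v : H, Complex.I • T (Γ (Complex.I • T (Γ v))) = ε • v) := by
  have hJJ (v : H) : Complex.I • Complex.I • v = -v := by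
    rw [smul_smul, Complex.I_mul_I, neg_one_smul]
  have hTJ (v : H) : T (Complex.I • v) = -(Complex.I • T v) := by
    rw [map_smulₛₗ, Complex.conj_I, neg_smul]
  refine ⟨fun v => ?_, fun v => ?_, fun v => ?_, hJJ, hT2, fun v => ?_⟩
  · rw [hTJ, neg_neg]
  · rw [map_smul, hTJ, smul_neg, neg_neg]
  · rw [hTJ, hΓT]
  · rw [map_smul, hΓT, hΓ2, hTJ, smul_neg, hJJ, neg_neg, hT2]
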